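/- arXiv:1601.03059 — 2 statements merged into one kernel-verified Lean document; each statement's English description precedes it below -/
import Mathlib

section
/- The Gödel translation tr embeds IEL into S4V soundly: if IEL ⊢ F then S4V ⊢ tr(F). -/
/-- Formulas of intuitionistic epistemic logic. -/
inductive IForm : Type
  | atom : ℕ → IForm
  | bot  : IForm
  | and  : IForm → IForm → IForm
  | or   : IForm → IForm → IForm
  | imp  : IForm → IForm → IForm
  | K    : IForm → IForm

def IForm.neg (A : IForm) : IForm := A.imp .bot

/-- Hilbert-style derivability for IEL⁻ together with an extra axiom set `Ax`. -/
inductive IELDeriv (Ax : IForm → Prop) : IForm → Prop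
  | extra {A : IForm} : Ax A → IELDeriv Ax A
  | a1 (A B : IForm) : IELDeriv Ax (A.imp (B.imp A))
  | a2 (A B C : IForm) : IELDeriv Ax ((A.imp (B.imp C)).imp ((A.imp B).imp (A.imp C)))
  | andI (A B : IForm) : IELDeriv Ax (A.imp (B.imp (A.and B)))
  | andE1 (A B : IForm) : IELDeriv Ax ((A.and B).imp A)
  | andE2 (A B : IForm) : IELDeriv Ax ((A.and B).imp B)
  | orI1 (A B : IForm) : IELDeriv Ax (A.imp (A.or B))
  | orI2 (A B : IForm) : IELDeriv Ax (B.imp (A.or B))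
  | orE (A B C : IForm) : IELDeriv Ax ((A.imp C).imp ((B.imp C).imp ((A.or B).imp C)))
  | exfalso (A : IForm) : IELDeriv Ax (IForm.bot.imp A)
  | kdist (A B : IForm) : IELDeriv Ax ((IForm.K (A.imp B)).imp ((IForm.K A).imp (IForm.K B)))
  | coref (A : IForm) : IELDeriv Ax (A.imp (IForm.K A))
  | mp {A B : IForm} : IELDeriv Ax (A.imp B) → IELDeriv Ax A → IELDeriv Ax B

/-- Derivability in IEL⁻. -/
def IELm : IForm → Prop := IELDeriv (fun _ => False)

/-- Derivability in IEL: IEL⁻ plus the axiom schema KA → ¬¬A. -/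
def IEL : IForm → Prop :=
  IELDeriv (fun F => ∃ A : IForm, F = (IForm.K A).imp A.neg.neg)


/-- Formulas of classical bimodal logic with □ (provability) and V (verification). -/
inductive MForm : Type
  | atom : ℕ → MForm
  | bot  : MForm
  | and  : MForm → MForm → MForm
  | or   : MForm → MForm → MForm
  | imp  : MForm → MForm → MForm
  | box  : MForm → MForm
  | V    : MForm → MForm

def MForm.neg (A : MForm) : MForm := A.imp .bot

/-- Hilbert-style derivability for S4V⁻ (`strong = false`) and S4V (`strong = true`,
adding the axiom ¬□V⊥). -/
inductive S4VDeriv (strong : Bool) : MForm → Prop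
  | a1 (A B : MForm) : S4VDeriv strong (A.imp (B.imp A))
  | a2 (A B C : MForm) : S4VDeriv strong ((A.imp (B.imp C)).imp ((A.imp B).imp (A.imp C)))
  | andI (A B : MForm) : S4VDeriv strong (A.imp (B.imp (A.and B)))
  | andE1 (A B : MForm) : S4VDeriv strong ((A.and B).imp A)
  | andE2 (A B : MForm) : S4VDeriv strong ((A.and B).imp B)
  | orI1 (A B : MForm) : S4VDeriv strong (A.imp (A.or B))
  | orI2 (A B : MForm) : S4VDeriv strong (B.imp (A.or B))
  | orE (A B C : MForm) : S4VDeriv strong ((A.imp C).imp ((B.imp C).imp ((A.or B).imp C)))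
  | exfalso (A : MForm) : S4VDeriv strong (MForm.bot.imp A)
  | dne (A : MForm) : S4VDeriv strong (A.neg.neg.imp A)
  | boxK (A B : MForm) : S4VDeriv strong ((A.imp B).box.imp (A.box.imp B.box))
  | boxT (A : MForm) : S4VDeriv strong (A.box.imp A)
  | box4 (A : MForm) : S4VDeriv strong (A.box.imp A.box.box)
  | vK (A B : MForm) : S4VDeriv strong ((MForm.V (A.imp B)).imp ((MForm.V A).imp (MForm.V B)))
  | boxV (A : MForm) : S4VDeriv strong (A.box.imp (MForm.V A))
  | consis : strong = true → S4VDeriv strong ((MForm.V MForm.bot).box.neg)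
  | mp {A B : MForm} : S4VDeriv strong (A.imp B) → S4VDeriv strong A → S4VDeriv strong B
  | nec {A : MForm} : S4VDeriv strong A → S4VDeriv strong A.box

/-- The Gödel translation, boxing every subformula and sending K to V. -/
def IForm.tr : IForm → MForm
  | .atom n => (MForm.atom n).box
  | .bot => MForm.bot.box
  | .and A B => (A.tr.and B.tr).box
  | .or A B => (A.tr.or B.tr).box
  | .imp A B => (A.tr.imp B.tr).box
  | .K A => (MForm.V A.tr).box

/-- Derivability of `A` in S4V from the translations of the formulas in `Γ`. -/
def Ent : List IForm → MForm → Prop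
  | [], A => S4VDeriv true A
  | X :: Γ, A => Ent Γ (X.tr.imp A)

theorem Ent.thm : ∀ (Γ : List IForm) {A : MForm}, S4VDeriv true A → Ent Γ A
  | [], _, h => h
  | _ :: Γ, _, h => Ent.thm Γ (.mp (.a1 _ _) h)

theorem Ent.mp : ∀ {Γ : List IForm} {A B : MForm}, Ent Γ (A.imp B) → Ent Γ A → Ent Γ B
  | [], _, _, h, k => S4VDeriv.mp h k
  | _ :: Γ, _, _, h, k =>
    Ent.mp (Γ := Γ) (Ent.mp (Γ := Γ) (Ent.thm Γ (.a2 _ _ _)) h) k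

theorem Ent.ap {Γ : List IForm} {A B : MForm} (h : S4VDeriv true (A.imp B))
    (k : Ent Γ A) : Ent Γ B := Ent.mp (Ent.thm Γ h) k

theorem Ent.weak {Γ : List IForm} {X : IForm} {A : MForm} (h : Ent Γ A) : Ent (X :: Γ) A :=
  Ent.ap (Γ := Γ) (.a1 _ _) h

theorem Ent.hd {Γ : List IForm} {X : IForm} : Ent (X :: Γ) X.tr :=
  Ent.thm Γ (.mp (.mp (.a2 _ (X.tr.imp X.tr) _) (.a1 _ _)) (.a1 _ _))

theorem tr_stable (X : IForm) : S4VDeriv true (X.tr.imp X.tr.box) := by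
  cases X <;> exact .box4 _

theorem Ent.nec : ∀ {Γ : List IForm} {A : MForm}, Ent Γ A → Ent Γ A.box
  | [], _, h => S4VDeriv.nec h
  | X :: Γ, A, h => by
    have h1 : Ent Γ (X.tr.imp A).box := Ent.nec (Γ := Γ) h
    have h2 : Ent Γ (X.tr.box.imp A.box) := Ent.ap (.boxK _ _) h1
    exact Ent.mp (Γ := X :: Γ) (Ent.weak h2) (Ent.ap (tr_stable X) Ent.hd)

theorem Ent.intro {Γ : List IForm} {X Y : IForm} (h : Ent (X :: Γ) Y.tr) :
    Ent Γ (X.imp Y).tr := Ent.nec (Γ := Γ) h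

theorem Ent.un {Γ : List IForm} {A : MForm} (h : Ent Γ A.box) : Ent Γ A :=
  Ent.ap (.boxT _) h

theorem Ent.elim {Γ : List IForm} {X Y : IForm} (h : Ent Γ (X.imp Y).tr) (k : Ent Γ X.tr) :
    Ent Γ Y.tr := Ent.mp (Ent.un h) k

theorem Ent.refl (A : IForm) (Γ : List IForm) (h : Ent Γ (A.K).tr) (k : Ent Γ A.neg.tr) :
    Ent Γ IForm.bot.tr := by
  have h1 : Ent Γ (MForm.V A.tr) := Ent.un h
  have k1 : Ent Γ (A.tr.imp MForm.bot.box) := Ent.un k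
  have k2 : Ent Γ (A.tr.imp MForm.bot) :=
    Ent.mp (Ent.ap (.a2 _ _ _) (Ent.thm Γ (.mp (.a1 _ _) (.boxT _)))) k1
  have k3 : Ent Γ (MForm.V (A.tr.imp MForm.bot)) := Ent.ap (.boxV _) (Ent.nec k2)
  have k4 : Ent Γ (MForm.V MForm.bot) := Ent.mp (Ent.ap (.vK _ _) k3) h1
  exact Ent.nec (Ent.ap (.consis rfl) (Ent.nec k4))

/-- The Gödel translation soundly embeds IEL into S4V:
if IEL ⊢ F then S4V ⊢ tr(F). -/
theorem godel_embedding_iel (F : IForm) (h : IEL F) : S4VDeriv true F.tr := by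
  suffices h : Ent [] F.tr from h
  unfold IEL at h
  induction h with
  | extra h =>
    obtain ⟨A, rfl⟩ := h
    exact .intro (.intro (Ent.refl A _ (.weak .hd) .hd))
  | a1 A B => exact .intro (.intro (.weak .hd))
  | a2 A B C =>
    exact .intro (.intro (.intro (.elim (.elim (.weak (.weak .hd)) .hd)
      (.elim (.weak .hd) .hd))))
  | andI A B => exact .intro (.intro (.nec (.mp (.ap (.andI _ _) (.weak .hd)) .hd)))
  | andE1 A B => exact .intro (.ap (.andE1 A.tr B.tr) (.un .hd))
  | andE2 A B => exact .intro (.ap (.andE2 A.tr B.tr) (.un .hd))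
  | orI1 A B => exact .intro (.nec (.ap (.orI1 _ _) .hd))
  | orI2 A B => exact .intro (.nec (.ap (.orI2 _ _) .hd))
  | orE A B C =>
    exact .intro (.intro (.intro (.mp (.mp (.ap (.orE A.tr B.tr C.tr)
      (.un (.weak (.weak .hd)))) (.un (.weak .hd))) (.un .hd))))
  | exfalso A => exact .intro (.ap (.exfalso _) (.un .hd))
  | kdist A B =>
    refine .intro (.intro (.nec (.mp (.ap (.vK A.tr B.tr) (.mp (.ap (.vK _ _) ?_)
      (.un (.weak .hd)))) (.un .hd))))
    exact Ent.thm _ (.mp (.boxV _) (.nec (.boxT _)))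
  | coref A => exact .intro (.nec (.ap (.boxV _) (.nec .hd)))
  | mp _ _ ih1 ih2 => exact .elim ih1 ih2
end

section
/- Proof realisability of IEL: if IEL ⊢ F then (tr(F))^r is a theorem of LPV for some normal realisation r, where tr is the Gödel translation boxing every subformula; similarly if IEL⁻ ⊢ F then (tr(F))^r is a theorem of LPV⁻ for some normal realisation r. -/
/-- Proof terms of the logic of proofs. -/
inductive Tm : Type
  | var   : ℕ → Tm
  | const : ℕ → Tm
  | app   : Tm → Tm → Tm
  | sum   : Tm → Tm → Tm
  | bang  : Tm → Tm

/-- A ground term contains no proof variables. -/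
def Tm.ground : Tm → Prop
  | .var _ => False
  | .const _ => True
  | .app t s => t.ground ∧ s.ground
  | .sum t s => t.ground ∧ s.ground
  | .bang t => t.ground

/-- Proof variables occurring in a term. -/
def Tm.vars : Tm → List ℕ
  | .var x => [x]
  | .const _ => []
  | .app t s => t.vars ++ s.vars
  | .sum t s => t.vars ++ s.vars
  | .bang t => t.vars

/-- Formulas of the logics LPV⁻ / LPV of explicit proofs and verification. -/
inductive LForm : Type
  | atom : ℕ → LForm
  | bot  : LForm
  | and  : LForm → LForm → LForm
  | or   : LForm → LForm → LForm
  | imp  : LForm → LForm → LForm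
  | V    : LForm → LForm
  | pf   : Tm → LForm → LForm

def LForm.neg (A : LForm) : LForm := A.imp .bot

/-- Proof variables occurring in a formula. -/
def LForm.vars : LForm → List ℕ
  | .atom _ => []
  | .bot => []
  | .and A B => A.vars ++ B.vars
  | .or A B => A.vars ++ B.vars
  | .imp A B => A.vars ++ B.vars
  | .V A => A.vars
  | .pf t A => t.vars ++ A.vars

/-- Axioms of LPV⁻ (`strong = false`) and LPV (`strong = true`, adding ¬t:V⊥). -/
inductive LAxiom (strong : Bool) : LForm → Prop
  | a1 (A B : LForm) : LAxiom strong (A.imp (B.imp A))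
  | a2 (A B C : LForm) : LAxiom strong ((A.imp (B.imp C)).imp ((A.imp B).imp (A.imp C)))
  | andI (A B : LForm) : LAxiom strong (A.imp (B.imp (A.and B)))
  | andE1 (A B : LForm) : LAxiom strong ((A.and B).imp A)
  | andE2 (A B : LForm) : LAxiom strong ((A.and B).imp B)
  | orI1 (A B : LForm) : LAxiom strong (A.imp (A.or B))
  | orI2 (A B : LForm) : LAxiom strong (B.imp (A.or B))
  | orE (A B C : LForm) : LAxiom strong ((A.imp C).imp ((B.imp C).imp ((A.or B).imp C)))
  | exfalso (A : LForm) : LAxiom strong (LForm.bot.imp A)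
  | dne (A : LForm) : LAxiom strong (A.neg.neg.imp A)
  | appAx (t s : Tm) (A B : LForm) :
      LAxiom strong ((LForm.pf t (A.imp B)).imp ((LForm.pf s A).imp (LForm.pf (t.app s) B)))
  | reflAx (t : Tm) (A : LForm) : LAxiom strong ((LForm.pf t A).imp A)
  | checkAx (t : Tm) (A : LForm) :
      LAxiom strong ((LForm.pf t A).imp (LForm.pf t.bang (LForm.pf t A)))
  | sum1 (t s : Tm) (A : LForm) : LAxiom strong ((LForm.pf t A).imp (LForm.pf (s.sum t) A))
  | sum2 (t s : Tm) (A : LForm) : LAxiom strong ((LForm.pf t A).imp (LForm.pf (t.sum s) A))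
  | vK (A B : LForm) : LAxiom strong ((LForm.V (A.imp B)).imp ((LForm.V A).imp (LForm.V B)))
  | pfV (t : Tm) (A : LForm) : LAxiom strong ((LForm.pf t A).imp (LForm.V A))
  | consis (t : Tm) : strong = true → LAxiom strong (LForm.pf t (LForm.V LForm.bot)).neg

/-- Hilbert-style derivability for LPV⁻ / LPV from a list of hypotheses, with
modus ponens and axiom necessitation. -/
inductive LDerivCtx (strong : Bool) (Γ : List LForm) : LForm → Prop
  | hyp {A : LForm} : A ∈ Γ → LDerivCtx strong Γ A
  | ax {A : LForm} : LAxiom strong A → LDerivCtx strong Γ A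
  | mp {A B : LForm} : LDerivCtx strong Γ (A.imp B) → LDerivCtx strong Γ A → LDerivCtx strong Γ B
  | nec {A : LForm} (c : ℕ) : LAxiom strong A → LDerivCtx strong Γ (LForm.pf (Tm.const c) A)

/-- Derivability in LPV⁻ / LPV (no hypotheses). -/
def LDeriv (strong : Bool) (A : LForm) : Prop := LDerivCtx strong [] A

/-- `Realz p F G` : the LPV-formula `G` is obtained from the modal formula `F`
(occurring with polarity `p`, `true` = positive) by substituting a proof term for
each occurrence of □, where every negative occurrence of □ receives a proof
variable (normality). -/
inductive Realz : Bool → MForm → LForm → Prop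
  | atom (p : Bool) (n : ℕ) : Realz p (MForm.atom n) (LForm.atom n)
  | bot (p : Bool) : Realz p MForm.bot LForm.bot
  | and {p : Bool} {A B : MForm} {A' B' : LForm} :
      Realz p A A' → Realz p B B' → Realz p (A.and B) (A'.and B')
  | or {p : Bool} {A B : MForm} {A' B' : LForm} :
      Realz p A A' → Realz p B B' → Realz p (A.or B) (A'.or B')
  | imp {p : Bool} {A B : MForm} {A' B' : LForm} :
      Realz (!p) A A' → Realz p B B' → Realz p (A.imp B) (A'.imp B')
  | V {p : Bool} {A : MForm} {A' : LForm} : Realz p A A' → Realz p (MForm.V A) (LForm.V A')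
  | boxPos {A : MForm} {A' : LForm} (t : Tm) :
      Realz true A A' → Realz true A.box (LForm.pf t A')
  | boxNeg {A : MForm} {A' : LForm} (x : ℕ) :
      Realz false A A' → Realz false A.box (LForm.pf (Tm.var x) A')

namespace IELReal

open LForm

/-! ### Basic derivability -/

theorem ded {b : Bool} {A B : LForm} (h : LDeriv b (A.imp B)) (h' : LDeriv b A) : LDeriv b B :=
  LDerivCtx.mp h h'

theorem dax {b : Bool} {A : LForm} (h : LAxiom b A) : LDeriv b A := LDerivCtx.ax h

theorem internalise {b : Bool} {A : LForm} (h : LDeriv b A) : ∃ t, LDeriv b (pf t A) := by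
  unfold LDeriv at h
  induction h with
  | hyp h => simp at h
  | ax h => exact ⟨.const 0, .nec 0 h⟩
  | mp _ _ ih1 ih2 =>
    obtain ⟨t, ht⟩ := ih1
    obtain ⟨s, hs⟩ := ih2
    exact ⟨t.app s, ded (ded (dax (.appAx _ _ _ _)) ht) hs⟩
  | nec c h => exact ⟨(Tm.const c).bang, ded (dax (.checkAx _ _)) (.nec c h)⟩

def bigor : List LForm → LForm
  | [] => .bot
  | A :: L => A.or (bigor L)

/-! ### Substitution -/

def tsub (s : ℕ → Tm) : Tm → Tm
  | .var x => s x
  | .const c => .const c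
  | .app t r => .app (tsub s t) (tsub s r)
  | .sum t r => .sum (tsub s t) (tsub s r)
  | .bang t => .bang (tsub s t)

def sub (s : ℕ → Tm) : LForm → LForm
  | .atom n => .atom n
  | .bot => .bot
  | .and A B => .and (sub s A) (sub s B)
  | .or A B => .or (sub s A) (sub s B)
  | .imp A B => .imp (sub s A) (sub s B)
  | .V A => .V (sub s A)
  | .pf t A => .pf (tsub s t) (sub s A)

theorem schema_sub {b : Bool} (s : ℕ → Tm) {A : LForm} (h : LAxiom b A) : LAxiom b (sub s A) := by
  cases h <;> simp only [sub, tsub, LForm.neg] <;> constructor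
  assumption

theorem deriv_sub {b : Bool} (s : ℕ → Tm) {A : LForm} (h : LDeriv b A) : LDeriv b (sub s A) := by
  unfold LDeriv at h
  induction h with
  | hyp h => simp at h
  | ax h => exact .ax (schema_sub s h)
  | mp _ _ ih1 ih2 => exact ded ih1 ih2
  | nec c h => exact .nec c (schema_sub s h)

/-! ### Uniform proof-term combinators -/

def PD (b : Bool) (w : Tm) (A : LForm) : Prop := LDeriv b (pf w A)

abbrev c0 : Tm := .const 0

section
variable {b : Bool}

theorem PD.ax {A : LForm} (h : LAxiom b A) : PD b c0 A := .nec 0 h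
theorem PD.app {w v : Tm} {A B : LForm} (h : PD b w (A.imp B)) (h' : PD b v A) :
    PD b (w.app v) B := ded (ded (dax (.appAx _ _ _ _)) h) h'
theorem PD.sumL {w : Tm} (v : Tm) {A : LForm} (h : PD b w A) : PD b (w.sum v) A :=
  ded (dax (.sum2 _ _ _)) h
theorem PD.sumR {w : Tm} (v : Tm) {A : LForm} (h : PD b w A) : PD b (v.sum w) A :=
  ded (dax (.sum1 _ _ _)) h
theorem PD.bang {w : Tm} {A : LForm} (h : PD b w A) : PD b w.bang (pf w A) :=
  ded (dax (.checkAx _ _)) h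
theorem PD.refl {w : Tm} {A : LForm} (h : PD b w A) : LDeriv b A :=
  ded (dax (.reflAx _ _)) h

def tI : Tm := (c0.app c0).app c0
theorem PD.I (A : LForm) : PD b tI (A.imp A) :=
  ((PD.ax (.a2 A (A.imp A) A)).app (PD.ax (.a1 _ _))).app (PD.ax (.a1 A A))

theorem PD.K {w : Tm} (A : LForm) {B : LForm} (h : PD b w B) : PD b (c0.app w) (A.imp B) :=
  (PD.ax (.a1 _ _)).app h

theorem PD.S {w v : Tm} {A B C : LForm} (h : PD b w (A.imp (B.imp C))) (h' : PD b v (A.imp B)) :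
    PD b ((c0.app w).app v) (A.imp C) := ((PD.ax (.a2 _ _ _)).app h).app h'

def tcomp (w v : Tm) : Tm := (c0.app (c0.app v)).app w
theorem PD.comp {w v : Tm} {A B C : LForm} (h : PD b w (A.imp B)) (h' : PD b v (B.imp C)) :
    PD b (tcomp w v) (A.imp C) := PD.S (PD.K A h') h

theorem impMono (w v : Tm) : ∃ r, ∀ {A A' B B' : LForm}, PD b w (A'.imp A) → PD b v (B.imp B') →
    PD b r ((A.imp B).imp (A'.imp B')) := by
  apply Exists.intro
  intro A A' B B' h h'
  exact ((PD.ax (.a1 (A.imp B) A')).comp (PD.ax (.a2 A' A B))).S (PD.K _ h) |>.comp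
    ((PD.ax (.a2 A' B B')).app (PD.K _ h'))

theorem andMono (w v : Tm) : ∃ r, ∀ {A A' B B' : LForm}, PD b w (A.imp A') → PD b v (B.imp B') →
    PD b r ((A.and B).imp (A'.and B')) := by
  apply Exists.intro
  intro A A' B B' h h'
  exact (((PD.ax (.andE1 A B)).comp h).comp (PD.ax (.andI A' B'))).S ((PD.ax (.andE2 A B)).comp h')

theorem orMono (w v : Tm) : ∃ r, ∀ {A A' B B' : LForm}, PD b w (A.imp A') → PD b v (B.imp B') →
    PD b r ((A.or B).imp (A'.or B')) := by
  apply Exists.intro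
  intro A A' B B' h h'
  exact ((PD.ax (.orE _ _ _)).app (h.comp (PD.ax (.orI1 A' B')))).app
    (h'.comp (PD.ax (.orI2 A' B')))

theorem vMono (w : Tm) : ∃ r, ∀ {A A' : LForm}, PD b w (A.imp A') →
    PD b r ((V A).imp (V A')) := by
  apply Exists.intro
  intro A A' h
  exact (PD.ax (.vK _ _)).app ((PD.ax (.pfV _ _)).app h.bang)

theorem pfMono (w : Tm) : ∃ r, ∀ {A A' : LForm} (t : Tm), PD b w (A.imp A') →
    PD b r ((pf t A).imp (pf (w.app t) A')) := by
  apply Exists.intro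
  intro A A' t h
  exact (PD.ax (.appAx _ _ _ _)).app h.bang

theorem bigorElim (w : Tm) (L : List LForm) : ∃ r, ∀ (s : ℕ → Tm) (G : LForm),
    (∀ Y ∈ L, PD b w ((sub s Y).imp G)) → PD b r ((sub s (bigor L)).imp G) := by
  induction L with
  | nil => exact ⟨c0, fun s G _ => PD.ax (.exfalso _)⟩
  | cons A L ih =>
    obtain ⟨r, hr⟩ := ih
    apply Exists.intro
    intro s G h
    exact ((PD.ax (.orE _ _ _)).app (h A (by simp))).app
      (hr s G (fun Y hY => h Y (by simp [hY])))

theorem bigorElims (w : Tm) (LL : List (List LForm)) : ∃ r, ∀ (s : ℕ → Tm) (G : LForm),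
    (∀ L ∈ LL, ∀ Y ∈ L, PD b w ((sub s Y).imp G)) →
    ∀ L ∈ LL, PD b r ((sub s (bigor L)).imp G) := by
  induction LL with
  | nil => exact ⟨c0, by simp⟩
  | cons A LL ih =>
    obtain ⟨r, hr⟩ := ih
    obtain ⟨q, hq⟩ := bigorElim (b := b) w A
    refine ⟨q.sum r, fun s G h L hL => ?_⟩
    rcases List.mem_cons.1 hL with rfl | hL
    · exact (hq s G (h _ (by simp))).sumL _
    · exact (hr s G (fun L hL => h L (by simp [hL])) L hL).sumR _

theorem sumTerms (T : List Tm) : ∃ w, ∀ s : ℕ → Tm, ∃ q, ∀ t ∈ T, ∀ B : LForm,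
    PD b w ((pf (tsub s t) B).imp (pf q B)) := by
  induction T with
  | nil => exact ⟨c0, fun s => ⟨c0, by simp⟩⟩
  | cons t T ih =>
    obtain ⟨w, hw⟩ := ih
    refine ⟨c0.sum (tcomp w c0), fun s => ?_⟩
    obtain ⟨q, hq⟩ := hw s
    refine ⟨(tsub s t).sum q, fun t' ht' B => ?_⟩
    rcases List.mem_cons.1 ht' with rfl | h
    · exact (PD.ax (.sum2 _ _ _)).sumL _
    · exact ((hq _ h B).comp (PD.ax (.sum1 _ _ _))).sumR _

end

/-! ### Quasi-realisations -/

def vr (l : List Bool) : ℕ := Encodable.encode l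

def Q : MForm → Bool → List Bool → LForm → Prop
  | .atom n, _, _, X => X = .atom n
  | .bot, _, _, X => X = .bot
  | .and A B, p, l, X => ∃ Y Z, Q A p (true :: l) Y ∧ Q B p (false :: l) Z ∧ X = Y.and Z
  | .or A B, p, l, X => ∃ Y Z, Q A p (true :: l) Y ∧ Q B p (false :: l) Z ∧ X = Y.or Z
  | .imp A B, p, l, X => ∃ Y Z, Q A (!p) (true :: l) Y ∧ Q B p (false :: l) Z ∧ X = Y.imp Z
  | .V A, true, l, X => ∃ L : List LForm, (∀ Y ∈ L, Q A true (true :: l) Y) ∧ X = .V (bigor L)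
  | .V A, false, l, X => ∃ Y, Q A false (true :: l) Y ∧ X = .V Y
  | .box A, true, l, X => ∃ (L : List LForm) (t : Tm), (∀ Y ∈ L, Q A true (true :: l) Y) ∧
      X = .pf t (bigor L)
  | .box A, false, l, X => ∃ Y, Q A false (true :: l) Y ∧ X = .pf (.var (vr l)) Y

theorem Q_nonempty (A : MForm) : ∀ p l, ∃ X, Q A p l X := by
  induction A with
  | atom n => intro p l; exact ⟨_, rfl⟩
  | bot => intro p l; exact ⟨_, rfl⟩
  | and A B ihA ihB | or A B ihA ihB =>
    intro p l
    obtain ⟨X, hX⟩ := ihA p (true :: l)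
    obtain ⟨Y, hY⟩ := ihB p (false :: l)
    exact ⟨_, X, Y, hX, hY, rfl⟩
  | imp A B ihA ihB =>
    intro p l
    obtain ⟨X, hX⟩ := ihA (!p) (true :: l)
    obtain ⟨Y, hY⟩ := ihB p (false :: l)
    exact ⟨_, X, Y, hX, hY, rfl⟩
  | V A ih =>
    intro p l
    cases p
    · obtain ⟨X, hX⟩ := ih false (true :: l)
      exact ⟨_, X, hX, rfl⟩
    · exact ⟨_, [], by simp, rfl⟩
  | box A ih =>
    intro p l
    cases p
    · obtain ⟨X, hX⟩ := ih false (true :: l)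
      exact ⟨_, X, hX, rfl⟩
    · exact ⟨_, [], c0, by simp, rfl⟩

theorem split_list {α β : Type} {P : α → Prop} {R : β → Prop} {f : α → β → LForm} (L : List LForm)
    (h : ∀ X ∈ L, ∃ a c, P a ∧ R c ∧ X = f a c) :
    ∃ (L1 : List α) (L2 : List β), (∀ a ∈ L1, P a) ∧ (∀ c ∈ L2, R c) ∧
      ∀ X ∈ L, ∃ a ∈ L1, ∃ c ∈ L2, X = f a c := by
  induction L with
  | nil => exact ⟨[], [], by simp, by simp, by simp⟩
  | cons X L ih =>
    obtain ⟨L1, L2, h1, h2, h3⟩ := ih (fun X hX => h X (by simp [hX]))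
    obtain ⟨a, c, ha, hc, rfl⟩ := h X (by simp)
    refine ⟨a :: L1, c :: L2, by simpa using ⟨ha, h1⟩, by simpa using ⟨hc, h2⟩, ?_⟩
    intro Y hY
    rcases List.mem_cons.1 hY with rfl | hY
    · exact ⟨a, by simp, c, by simp, rfl⟩
    · obtain ⟨a', ha', c', hc', e⟩ := h3 Y hY
      exact ⟨a', by simp [ha'], c', by simp [hc'], e⟩

/-- the substitution `x ↦ u x · x` -/
def sg (u : List Bool → Tm) (x : ℕ) : Tm :=
  match (Encodable.decode x : Option (List Bool)) with
  | some l => (u l).app (.var x)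
  | none => .var x

theorem sg_vr (u : List Bool → Tm) (l : List Bool) : sg u (vr l) = (u l).app (.var (vr l)) := by
  simp [sg, vr]

def dir (p : Bool) (A B : LForm) : LForm := if p then A.imp B else B.imp A

def agree (l : List Bool) (u u' : List Bool → Tm) : Prop := ∀ q, l <:+ q → u' q = u q

def Good (b : Bool) (F : MForm) (p : Bool) : Prop :=
  ∀ (l : List Bool) (L : List LForm), (∀ X ∈ L, Q F p l X) →
    ∃ u w, ∀ u', agree l u u' → ∃ G, Realz p F G ∧ ∀ X ∈ L, PD b w (dir p (sub (sg u') X) G)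

theorem suffix_disj {l q : List Bool} (h : (true :: l) <:+ q) (h' : (false :: l) <:+ q) : False := by
  obtain ⟨a, rfl⟩ := h
  obtain ⟨c, e⟩ := h'
  have := (List.append_inj' e (by simp)).2
  simp at this

theorem agree_left {l : List Bool} {u1 u2 u' : List Bool → Tm} (h : agree l
    (fun q => open Classical in if (true :: l) <:+ q then u1 q else u2 q) u') :
    agree (true :: l) u1 u' := by
  intro q hq
  rw [h q ((List.suffix_cons _ _).trans hq)]; simp [hq]

theorem agree_right {l : List Bool} {u1 u2 u' : List Bool → Tm} (h : agree l
    (fun q => open Classical in if (true :: l) <:+ q then u1 q else u2 q) u') :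
    agree (false :: l) u2 u' := by
  intro q hq
  rw [h q ((List.suffix_cons _ _).trans hq)]
  refine if_neg ?_
  exact fun h' => suffix_disj h' hq

theorem agree_child {l : List Bool} {u u' : List Bool → Tm} (h : agree l u u') (a : Bool) : agree (a :: l) u u' :=
  fun q hq => h q ((List.suffix_cons _ _).trans hq)

theorem binary {b : Bool} {A B F : MForm} {p p' : Bool} {f : LForm → LForm → LForm}
    (hA : Good b A p') (hB : Good b B p)
    (hQ : ∀ l X, Q F p l X → ∃ Y Z, Q A p' (true :: l) Y ∧ Q B p (false :: l) Z ∧ X = f Y Z)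
    (hf : ∀ s Y Z, sub s (f Y Z) = f (sub s Y) (sub s Z))
    (hR : ∀ Y Z, Realz p' A Y → Realz p B Z → Realz p F (f Y Z))
    (hw : ∀ w v, ∃ r, ∀ Y Y' Z Z', PD b w (dir p' Y Y') → PD b v (dir p Z Z') →
      PD b r (dir p (f Y Z) (f Y' Z'))) : Good b F p := by
  intro l L hL
  obtain ⟨L1, L2, h1, h2, h3⟩ := split_list L (fun X hX => hQ l X (hL X hX))
  obtain ⟨u1, w1, H1⟩ := hA _ L1 h1
  obtain ⟨u2, w2, H2⟩ := hB _ L2 h2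
  obtain ⟨r, hr⟩ := hw w1 w2
  refine ⟨fun q => open Classical in if (true :: l) <:+ q then u1 q else u2 q, r,
    fun u' hu' => ?_⟩
  obtain ⟨G1, R1, P1⟩ := H1 u' (agree_left hu')
  obtain ⟨G2, R2, P2⟩ := H2 u' (agree_right hu')
  refine ⟨_, hR _ _ R1 R2, fun X hX => ?_⟩
  obtain ⟨a, ha, c, hc, rfl⟩ := h3 X hX
  rw [hf]
  exact hr _ _ _ _ (P1 a ha) (P2 c hc)

theorem good (b : Bool) (F : MForm) : ∀ p, Good b F p := by
  induction F with
  | atom n =>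
    intro p l L hL
    refine ⟨fun _ => c0, tI, fun u' _ => ⟨.atom n, .atom _ _, fun X hX => ?_⟩⟩
    have := hL X hX; simp only [Q] at this; subst this
    cases p <;> exact PD.I _
  | bot =>
    intro p l L hL
    refine ⟨fun _ => c0, tI, fun u' _ => ⟨.bot, .bot _, fun X hX => ?_⟩⟩
    have := hL X hX; simp only [Q] at this; subst this
    cases p <;> exact PD.I _
  | and A B ihA ihB =>
    intro p
    refine binary (f := LForm.and) (ihA p) (ihB p) (fun l X h => h) (fun _ _ _ => rfl)
      (fun _ _ => .and) (fun w v => ?_)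
    obtain ⟨r, hr⟩ := andMono (b := b) w v
    refine ⟨r, fun Y Y' Z Z' h h' => ?_⟩
    cases p <;> exact hr h h'
  | or A B ihA ihB =>
    intro p
    refine binary (f := LForm.or) (ihA p) (ihB p) (fun l X h => h) (fun _ _ _ => rfl)
      (fun _ _ => .or) (fun w v => ?_)
    obtain ⟨r, hr⟩ := orMono (b := b) w v
    refine ⟨r, fun Y Y' Z Z' h h' => ?_⟩
    cases p <;> exact hr h h'
  | imp A B ihA ihB =>
    intro p
    refine binary (f := LForm.imp) (ihA (!p)) (ihB p) (fun l X h => h) (fun _ _ _ => rfl)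
      (fun _ _ => .imp) (fun w v => ?_)
    obtain ⟨r, hr⟩ := impMono (b := b) w v
    refine ⟨r, fun Y Y' Z Z' h h' => ?_⟩
    cases p <;> exact hr h h'
  | V A ih =>
    intro p l L hL
    cases p
    · obtain ⟨L1, L2, h1, h2, h3⟩ := split_list (β := Unit) (R := fun _ => True)
        (P := Q A false (true :: l)) (f := fun Y _ => .V Y) L
        (fun X hX => by obtain ⟨Y, hY, e⟩ := hL X hX; exact ⟨Y, (), hY, trivial, e⟩)
      obtain ⟨u, w, H⟩ := ih false _ L1 h1
      obtain ⟨r, hr⟩ := vMono (b := b) w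
      refine ⟨u, r, fun u' hu' => ?_⟩
      obtain ⟨G, hG, P⟩ := H u' (agree_child hu' _)
      refine ⟨_, .V hG, fun X hX => ?_⟩
      obtain ⟨a, ha, _, _, rfl⟩ := h3 X hX
      exact hr (P a ha)
    · obtain ⟨L1, L2, h1, h2, h3⟩ := split_list (β := Unit) (R := fun _ => True)
        (P := fun M => ∀ Y ∈ M, Q A true (true :: l) Y) (f := fun Y _ => .V (bigor Y)) L
        (fun X hX => by obtain ⟨Y, hY, e⟩ := hL X hX; exact ⟨Y, (), hY, trivial, e⟩)
      obtain ⟨u, w, H⟩ := ih true _ L1.flatten (fun X hX => by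
        obtain ⟨M, hM, hX⟩ := List.mem_flatten.1 hX; exact h1 M hM X hX)
      obtain ⟨q, hq⟩ := bigorElims (b := b) w L1
      obtain ⟨r, hr⟩ := vMono (b := b) q
      refine ⟨u, r, fun u' hu' => ?_⟩
      obtain ⟨G, hG, P⟩ := H u' (agree_child hu' _)
      refine ⟨_, .V hG, fun X hX => ?_⟩
      obtain ⟨a, ha, _, _, rfl⟩ := h3 X hX
      exact hr (hq (sg u') G
        (fun M hM Y hY => P Y (List.mem_flatten.2 ⟨M, hM, hY⟩)) a ha)
  | box A ih =>
    intro p l L hL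
    cases p
    · obtain ⟨L1, L2, h1, h2, h3⟩ := split_list (β := Unit) (R := fun _ => True)
        (P := Q A false (true :: l)) (f := fun Y _ => .pf (.var (vr l)) Y) L
        (fun X hX => by obtain ⟨Y, hY, e⟩ := hL X hX; exact ⟨Y, (), hY, trivial, e⟩)
      obtain ⟨u, w, H⟩ := ih false _ L1 h1
      obtain ⟨r, hr⟩ := pfMono (b := b) w
      refine ⟨Function.update u l w, r, fun u' hu' => ?_⟩
      have hl : u' l = w := by rw [hu' l (List.suffix_refl _)]; simp
      obtain ⟨G, hG, P⟩ := H u' (fun q hq => by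
        rw [agree_child hu' _ q hq, Function.update_of_ne]
        rintro rfl
        have := hq.length_le
        simp at this)
      refine ⟨_, .boxNeg (vr l) hG, fun X hX => ?_⟩
      obtain ⟨a, ha, _, _, rfl⟩ := h3 X hX
      have := hr (.var (vr l)) (P a ha)
      simp only [dir, sub, tsub, sg_vr, hl]
      exact this
    · obtain ⟨L1, L2, h1, h2, h3⟩ := split_list (β := Tm) (R := fun _ => True)
        (P := fun M => ∀ Y ∈ M, Q A true (true :: l) Y) (f := fun Y t => .pf t (bigor Y)) L
        (fun X hX => by obtain ⟨Y, t, hY, e⟩ := hL X hX; exact ⟨Y, t, hY, trivial, e⟩)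
      obtain ⟨u, w, H⟩ := ih true _ L1.flatten (fun X hX => by
        obtain ⟨M, hM, hX⟩ := List.mem_flatten.1 hX; exact h1 M hM X hX)
      obtain ⟨q, hq⟩ := bigorElims (b := b) w L1
      obtain ⟨r, hr⟩ := pfMono (b := b) q
      obtain ⟨v, hv⟩ := sumTerms (b := b) L2
      refine ⟨u, tcomp v r, fun u' hu' => ?_⟩
      obtain ⟨G, hG, P⟩ := H u' (agree_child hu' _)
      obtain ⟨z, hz⟩ := hv (sg u')
      refine ⟨_, .boxPos (q.app z) hG, fun X hX => ?_⟩
      obtain ⟨a, ha, t, ht, rfl⟩ := h3 X hX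
      exact (hz t ht _).comp (hr z (hq (sg u') G
        (fun M hM Y hY => P Y (List.mem_flatten.2 ⟨M, hM, hY⟩)) a ha))

theorem realise {b : Bool} {F : MForm} {L : List LForm} (hL : ∀ X ∈ L, Q F true [] X)
    (h : LDeriv b (bigor L)) : ∃ G, Realz true F G ∧ LDeriv b G := by
  obtain ⟨u, w, H⟩ := good b F true [] L hL
  obtain ⟨G, hG, P⟩ := H u (fun _ _ => rfl)
  obtain ⟨r, hr⟩ := bigorElim (b := b) w L
  exact ⟨G, hG, ded (hr (sg u) G P).refl (deriv_sub _ h)⟩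

/-! ### Canonical model -/

inductive SD (b : Bool) (S : Set LForm) : LForm → Prop
  | hyp {A : LForm} : A ∈ S → SD b S A
  | thm {A : LForm} : LDeriv b A → SD b S A
  | mp {A B : LForm} : SD b S (A.imp B) → SD b S A → SD b S B

section
variable {b : Bool}

theorem SD.ax {S : Set LForm} {A : LForm} (h : LAxiom b A) : SD b S A := .thm (dax h)

theorem SD.mono {S T : Set LForm} (hST : S ⊆ T) {A : LForm} (h : SD b S A) : SD b T A := by
  induction h with
  | hyp h => exact .hyp (hST h)
  | thm h => exact .thm h
  | mp _ _ h h' => exact .mp h h'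

theorem SD.cut {S T : Set LForm} (hST : ∀ X ∈ S, SD b T X) {A : LForm} (h : SD b S A) :
    SD b T A := by
  induction h with
  | hyp h => exact hST _ h
  | thm h => exact .thm h
  | mp _ _ h h' => exact .mp h h'

theorem SD.deduct {S : Set LForm} {A B : LForm} (h : SD b (insert A S) B) : SD b S (A.imp B) := by
  induction h with
  | hyp h =>
    rcases h with rfl | h
    · exact .thm (PD.I _).refl
    · exact .mp (.ax (.a1 _ _)) (.hyp h)
  | thm h => exact .mp (.ax (.a1 _ _)) (.thm h)
  | mp _ _ h h' => exact .mp (.mp (.ax (.a2 _ _ _)) h) h'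

theorem SD.of_empty {A : LForm} (h : SD b ∅ A) : LDeriv b A := by
  induction h with
  | hyp h => exact h.elim
  | thm h => exact h
  | mp _ _ h h' => exact ded h h'

theorem bigorIntro {S : Set LForm} {L : List LForm} {X : LForm} (hX : X ∈ L) :
    SD b S (X.imp (bigor L)) := by
  induction L with
  | nil => simp at hX
  | cons A L ih =>
    rcases List.mem_cons.1 hX with rfl | h
    · exact .ax (.orI1 _ _)
    · exact .deduct (.mp (.ax (.orI2 _ _)) (.mp (ih h |>.mono (by simp)) (.hyp (by simp))))

theorem bigorCase {S : Set LForm} {L : List LForm} {G : LForm}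
    (h : ∀ X ∈ L, SD b S (X.imp G)) : SD b S ((bigor L).imp G) := by
  induction L with
  | nil => exact .ax (.exfalso _)
  | cons A L ih =>
    exact .mp (.mp (.ax (.orE _ _ _)) (h A (by simp))) (ih (fun X hX => h X (by simp [hX])))

theorem bigorSub {S : Set LForm} {L M : List LForm} (h : L ⊆ M) :
    SD b S ((bigor L).imp (bigor M)) := bigorCase (fun _ hX => bigorIntro (h hX))

theorem negSub {S : Set LForm} {L M : List LForm} (h : L ⊆ M) {A : LForm}
    (hA : SD b (insert (bigor L).neg S) A) : SD b (insert (bigor M).neg S) A := by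
  refine hA.cut (fun X hX => ?_)
  rcases hX with rfl | hX
  · refine .deduct (.mp (A := bigor M) (.hyp (by simp [LForm.neg])) ?_)
    exact .mp (bigorSub h) (.hyp (by simp))
  · exact .hyp (by simp [hX])

theorem compact_neg {S T : Set LForm} {A : LForm}
    (h : SD b (S ∪ LForm.neg '' T) A) :
    ∃ L : List LForm, (∀ X ∈ L, X ∈ T) ∧ SD b (insert (bigor L).neg S) A := by
  induction h with
  | hyp h =>
    rcases h with h | ⟨X, hX, rfl⟩
    · exact ⟨[], by simp, .hyp (by simp [h])⟩
    · refine ⟨[X], by simpa using hX, .deduct (.mp (A := bigor [X]) (.hyp (by simp [LForm.neg])) ?_)⟩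
      exact .mp (bigorIntro (X := X) (by simp)) (.hyp (by simp))
  | thm h => exact ⟨[], by simp, .thm h⟩
  | mp _ _ h h' =>
    obtain ⟨L, hL, h⟩ := h
    obtain ⟨M, hM, h'⟩ := h'
    refine ⟨L ++ M, ?_, .mp (negSub (by simp) h) (negSub (by simp) h')⟩
    intro X hX
    rcases List.mem_append.1 hX with h | h
    · exact hL X h
    · exact hM X h

theorem compact_or {S T : Set LForm} (h : SD b (S ∪ LForm.neg '' T) .bot) :
    ∃ L : List LForm, (∀ X ∈ L, X ∈ T) ∧ SD b S (bigor L) := by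
  obtain ⟨L, hL, h⟩ := compact_neg h
  exact ⟨L, hL, .mp (.ax (.dne _)) h.deduct⟩

end

structure World (b : Bool) where
  S : Set LForm
  con : ¬ SD b S .bot
  max : ∀ A, A ∈ S ∨ A.neg ∈ S

section
variable {b : Bool}

theorem World.closed (w : World b) {A : LForm} (h : SD b w.S A) : A ∈ w.S := by
  rcases w.max A with h' | h'
  · exact h'
  · exact (w.con (.mp (.hyp h') h)).elim

theorem World.mp (w : World b) {A B : LForm} (h : A.imp B ∈ w.S) (h' : A ∈ w.S) : B ∈ w.S :=
  w.closed (.mp (.hyp h) (.hyp h'))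

theorem World.ax (w : World b) {A : LForm} (h : LAxiom b A) : A ∈ w.S := w.closed (.ax h)

theorem World.neg_iff (w : World b) {A : LForm} : A.neg ∈ w.S ↔ A ∉ w.S := by
  constructor
  · intro h h'
    exact w.con (.mp (.hyp h) (.hyp h'))
  · intro h
    exact (w.max A).resolve_left h

theorem World.bot (w : World b) : LForm.bot ∉ w.S := fun h => w.con (.hyp h)

theorem World.imp_iff (w : World b) {A B : LForm} : A.imp B ∈ w.S ↔ (A ∈ w.S → B ∈ w.S) := by
  constructor
  · exact w.mp
  · intro h
    by_cases hA : A ∈ w.S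
    · exact w.mp (w.ax (.a1 _ _)) (h hA)
    · refine w.closed (.deduct (.mp (.ax (.exfalso _)) (.mp (A := A) (.hyp ?_) (.hyp (by simp)))))
      exact Or.inr (w.neg_iff.2 hA)

theorem World.and_iff (w : World b) {A B : LForm} : A.and B ∈ w.S ↔ (A ∈ w.S ∧ B ∈ w.S) :=
  ⟨fun h => ⟨w.mp (w.ax (.andE1 _ _)) h, w.mp (w.ax (.andE2 _ _)) h⟩,
    fun h => w.mp (w.mp (w.ax (.andI _ _)) h.1) h.2⟩

theorem World.or_iff (w : World b) {A B : LForm} : A.or B ∈ w.S ↔ (A ∈ w.S ∨ B ∈ w.S) := by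
  constructor
  · intro h
    by_contra hc
    rw [not_or, ← w.neg_iff, ← w.neg_iff] at hc
    exact w.bot (w.mp (w.mp (w.mp (w.ax (.orE _ _ _)) hc.1) hc.2) h)
  · rintro (h | h)
    · exact w.mp (w.ax (.orI1 _ _)) h
    · exact w.mp (w.ax (.orI2 _ _)) h

theorem chain_SD {c : Set (Set LForm)} (hc : IsChain (· ⊆ ·) c) (hne : c.Nonempty) {A : LForm}
    (h : SD b (⋃₀ c) A) : ∃ s ∈ c, SD b s A := by
  induction h with
  | hyp h => obtain ⟨s, hs, h⟩ := h; exact ⟨s, hs, .hyp h⟩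
  | thm h => obtain ⟨s, hs⟩ := hne; exact ⟨s, hs, .thm h⟩
  | mp _ _ h h' =>
    obtain ⟨s, hs, h⟩ := h
    obtain ⟨t, ht, h'⟩ := h'
    rcases hc.total hs ht with hst | hst
    · exact ⟨t, ht, .mp (h.mono hst) h'⟩
    · exact ⟨s, hs, .mp h (h'.mono hst)⟩

theorem lindenbaum {S : Set LForm} (h : ¬ SD b S .bot) : ∃ w : World b, S ⊆ w.S := by
  obtain ⟨M, hSM, hM⟩ := zorn_subset_nonempty {T : Set LForm | ¬ SD b T .bot}
    (fun c hc hch hne => ⟨⋃₀ c, fun hb => by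
      obtain ⟨s, hs, hb⟩ := chain_SD hch hne hb
      exact hc hs hb, fun s hs => Set.subset_sUnion_of_mem hs⟩) S h
  refine ⟨⟨M, hM.prop, fun A => ?_⟩, hSM⟩
  by_contra hc
  rw [not_or] at hc
  have key : ∀ B, B ∉ M → SD b M B.neg := fun B hB => by
    by_contra hn
    refine hB (hM.le_of_ge (y := insert B M) (fun hb => hn hb.deduct) (Set.subset_insert _ _)
      (Set.mem_insert _ _))
  exact hM.prop (.mp (key _ hc.2) (key _ hc.1))

def Rel (w v : World b) : Prop := ∀ t A, pf t A ∈ w.S → A ∈ v.S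
def RelV (w v : World b) : Prop := ∀ A, V A ∈ w.S → A ∈ v.S

theorem Rel.rfl (w : World b) : Rel w w := fun _ _ h => w.mp (w.ax (.reflAx _ _)) h
theorem Rel.trans {w v z : World b} (h : Rel w v) (h' : Rel v z) : Rel w z :=
  fun _ _ ht => h' _ _ (h _ _ (w.mp (w.ax (.checkAx _ _)) ht))
theorem RelV.rel {w v : World b} (h : RelV w v) : Rel w v :=
  fun _ _ ht => h _ (w.mp (w.ax (.pfV _ _)) ht)

theorem lift_pf (w : World b) {A : LForm} (h : SD b {Z | ∃ t, pf t Z ∈ w.S} A) :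
    ∃ t, pf t A ∈ w.S := by
  induction h with
  | hyp h => exact h
  | thm h => obtain ⟨t, ht⟩ := internalise h; exact ⟨t, w.closed (.thm ht)⟩
  | mp _ _ h h' =>
    obtain ⟨t, ht⟩ := h
    obtain ⟨s, hs⟩ := h'
    exact ⟨_, w.mp (w.mp (w.ax (.appAx _ _ _ _)) ht) hs⟩

theorem lift_V (w : World b) {A : LForm} (h : SD b {Z | V Z ∈ w.S} A) : V A ∈ w.S := by
  induction h with
  | hyp h => exact h
  | thm h =>
    obtain ⟨t, ht⟩ := internalise h
    exact w.mp (w.ax (.pfV _ _)) (w.closed (.thm ht))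
  | mp _ _ h h' => exact w.mp (w.mp (w.ax (.vK _ _)) h) h'

def force (w : World b) : MForm → Prop
  | .atom n => LForm.atom n ∈ w.S
  | .bot => False
  | .and A B => force w A ∧ force w B
  | .or A B => force w A ∨ force w B
  | .imp A B => force w A → force w B
  | .box A => ∀ v, Rel w v → force v A
  | .V A => ∀ v, RelV w v → force v A

theorem truth (F : MForm) : ∀ (l : List Bool) (w : World b),
    ((∀ X, Q F true l X → X ∉ w.S) → ¬ force w F) ∧
    ((∀ X, Q F false l X → X ∈ w.S) → force w F) := by
  induction F with
  | atom n => intro l w; exact ⟨fun h => h _ rfl, fun h => h _ rfl⟩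
  | bot => intro l w; exact ⟨fun _ h => h, fun h => w.bot (h _ rfl)⟩
  | and A B ihA ihB =>
    intro l w
    constructor
    · rintro h ⟨hA, hB⟩
      refine (ihA (true :: l) w).1 (fun X hX hXw => ?_) hA
      refine (ihB (false :: l) w).1 (fun Y hY hYw => ?_) hB
      exact h _ ⟨X, Y, hX, hY, rfl⟩ (w.and_iff.2 ⟨hXw, hYw⟩)
    · intro h
      obtain ⟨X0, hX0⟩ := Q_nonempty A false (true :: l)
      obtain ⟨Y0, hY0⟩ := Q_nonempty B false (false :: l)
      exact ⟨(ihA (true :: l) w).2 fun X hX => (w.and_iff.1 (h _ ⟨X, Y0, hX, hY0, rfl⟩)).1,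
        (ihB (false :: l) w).2 fun Y hY => (w.and_iff.1 (h _ ⟨X0, Y, hX0, hY, rfl⟩)).2⟩
  | or A B ihA ihB =>
    intro l w
    constructor
    · intro h
      obtain ⟨X0, hX0⟩ := Q_nonempty A true (true :: l)
      obtain ⟨Y0, hY0⟩ := Q_nonempty B true (false :: l)
      rintro (hA | hB)
      · exact (ihA (true :: l) w).1 (fun X hX hXw =>
          h _ ⟨X, Y0, hX, hY0, rfl⟩ (w.or_iff.2 (.inl hXw))) hA
      · exact (ihB (false :: l) w).1 (fun Y hY hYw =>
          h _ ⟨X0, Y, hX0, hY, rfl⟩ (w.or_iff.2 (.inr hYw))) hB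
    · intro h
      by_contra hc
      simp only [force, not_or] at hc
      refine hc.1 ((ihA (true :: l) w).2 fun X hX => ?_)
      by_contra hXw
      exact hc.2 ((ihB (false :: l) w).2 fun Y hY =>
        (w.or_iff.1 (h _ ⟨X, Y, hX, hY, rfl⟩)).resolve_left hXw)
  | imp A B ihA ihB =>
    intro l w
    constructor
    · intro h hAB
      obtain ⟨X0, hX0⟩ := Q_nonempty A false (true :: l)
      obtain ⟨Y0, hY0⟩ := Q_nonempty B true (false :: l)
      refine (ihB (false :: l) w).1 (fun Y hY hYw =>
        h _ ⟨X0, Y, hX0, hY, rfl⟩ (w.imp_iff.2 fun _ => hYw)) (hAB ?_)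
      refine (ihA (true :: l) w).2 (fun X hX => ?_)
      by_contra hXw
      exact h _ ⟨X, Y0, hX, hY0, rfl⟩ (w.imp_iff.2 fun hh => (hXw hh).elim)
    · intro h hA
      refine (ihB (false :: l) w).2 fun Y hY => ?_
      by_contra hYw
      exact (ihA (true :: l) w).1 (fun X hX hXw =>
        hYw (w.imp_iff.1 (h _ ⟨X, Y, hX, hY, rfl⟩) hXw)) hA
  | V A ih =>
    intro l w
    constructor
    · intro h hV
      by_cases hc : SD b ({Z | V Z ∈ w.S} ∪ LForm.neg '' {X | Q A true (true :: l) X}) .bot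
      · obtain ⟨L, hL, hd⟩ := compact_or hc
        exact h _ ⟨L, hL, rfl⟩ (lift_V w hd)
      · obtain ⟨v, hv⟩ := lindenbaum hc
        refine (ih (true :: l) v).1 (fun X hX => ?_) (hV v fun Z hZ => hv (.inl hZ))
        exact v.neg_iff.1 (hv (.inr ⟨X, hX, rfl⟩))
    · intro h v hv
      exact (ih (true :: l) v).2 fun X hX => hv _ (h _ ⟨X, hX, rfl⟩)
  | box A ih =>
    intro l w
    constructor
    · intro h hV
      by_cases hc : SD b ({Z | ∃ t, pf t Z ∈ w.S} ∪ LForm.neg '' {X | Q A true (true :: l) X}) .bot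
      · obtain ⟨L, hL, hd⟩ := compact_or hc
        obtain ⟨t, ht⟩ := lift_pf w hd
        exact h _ ⟨L, t, hL, rfl⟩ ht
      · obtain ⟨v, hv⟩ := lindenbaum hc
        refine (ih (true :: l) v).1 (fun X hX => ?_) (hV v fun t Z hZ => hv (.inl ⟨t, hZ⟩))
        exact v.neg_iff.1 (hv (.inr ⟨X, hX, rfl⟩))
    · intro h v hv
      exact (ih (true :: l) v).2 fun X hX => hv _ _ (h _ ⟨X, hX, rfl⟩)

theorem complete {F : MForm} (h : ∀ w : World b, force w F) :
    ∃ G, Realz true F G ∧ LDeriv b G := by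
  by_cases hc : SD b (∅ ∪ LForm.neg '' {X | Q F true [] X}) .bot
  · obtain ⟨L, hL, hd⟩ := compact_or hc
    exact realise hL hd.of_empty
  · obtain ⟨v, hv⟩ := lindenbaum hc
    exact ((truth F [] v).1 (fun X hX => v.neg_iff.1 (hv (.inr ⟨X, hX, rfl⟩))) (h v)).elim

/-! ### Soundness of IEL in the canonical model -/

theorem persist {w v : World b} (h : Rel w v) (A : IForm) (hA : force w A.tr) : force v A.tr := by
  cases A <;> exact fun z hz => hA z (h.trans hz)

theorem serial (hb : b = true) (w : World b) : ∃ v z : World b, Rel w v ∧ RelV v z := by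
  by_cases hc : SD b ({Z | ∃ t, pf t Z ∈ w.S} ∪ LForm.neg '' {V .bot}) .bot
  · obtain ⟨L, hL, hd⟩ := compact_or hc
    obtain ⟨t, ht⟩ := lift_pf w (SD.mp (bigorCase (G := V .bot) (fun X hX => by
      have := hL X hX
      simp only [Set.mem_singleton_iff] at this
      subst this
      exact .thm (PD.I _).refl)) hd)
    exact (w.neg_iff.1 (w.ax (.consis t hb)) ht).elim
  · obtain ⟨v, hv⟩ := lindenbaum hc
    have hvb : V .bot ∉ v.S := v.neg_iff.1 (hv (.inr ⟨_, rfl, rfl⟩))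
    obtain ⟨z, hz⟩ := lindenbaum (b := b) (S := {Z | V Z ∈ v.S}) (fun h => hvb (lift_V v h))
    exact ⟨v, z, fun t Z hZ => hv (.inl ⟨t, hZ⟩), fun Z hZ => hz hZ⟩

theorem sound {Ax : IForm → Prop} (hAx : ∀ F, Ax F → ∀ w : World b, force w F.tr) {F : IForm}
    (h : IELDeriv Ax F) : ∀ w : World b, force w F.tr := by
  induction h with
  | extra h => exact hAx _ h
  | a1 A B => exact fun w v _ hA z hz _ => persist hz A hA
  | a2 A B C =>
    exact fun w v _ h1 z hz h2 y hy hA =>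
      h1 y (hz.trans hy) hA y (Rel.rfl y) (h2 y hy hA)
  | andI A B =>
    exact fun w v _ hA z hz hB y hy => ⟨persist (hz.trans hy) A hA, persist hy B hB⟩
  | andE1 A B => exact fun w v _ h => (h v (Rel.rfl v)).1
  | andE2 A B => exact fun w v _ h => (h v (Rel.rfl v)).2
  | orI1 A B => exact fun w v _ h z hz => .inl (persist hz A h)
  | orI2 A B => exact fun w v _ h z hz => .inr (persist hz B h)
  | orE A B C =>
    exact fun w v _ h1 z hz h2 y hy h => (h y (Rel.rfl y)).elim
      (h1 y (hz.trans hy)) (h2 y hy)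
  | exfalso A => exact fun w v _ h => (h v (Rel.rfl v)).elim
  | kdist A B =>
    exact fun w v _ h1 z hz h2 y hy x hx =>
      h1 y (hz.trans hy) x hx x (Rel.rfl x) (h2 y hy x hx)
  | coref A => exact fun w v _ hA z hz y hy => persist (hz.trans hy.rel) A hA
  | mp _ _ h h' => exact fun w => h w w (Rel.rfl w) (h' w)

theorem sound_strong (hb : b = true) (A : IForm) (w : World b) :
    force w ((IForm.K A).imp A.neg.neg).tr := by
  intro v _ hK z hz hn
  obtain ⟨y, x, hy, hx⟩ := serial hb z
  exact (hn x (hy.trans hx.rel) (hK y (hz.trans hy) x hx) x (Rel.rfl x)).elim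

end

end IELReal

/-- Proof realisability: if IEL ⊢ F then (tr F)^r is a theorem of
LPV for some normal realisation r, and if IEL⁻ ⊢ F then (tr F)^r is a theorem
of LPV⁻ for some normal realisation r. -/
theorem iel_proof_realisability (F : IForm) :
    (IEL F → ∃ G : LForm, Realz true F.tr G ∧ LDeriv true G) ∧
    (IELm F → ∃ G : LForm, Realz true F.tr G ∧ LDeriv false G) := by
  constructor
  · intro h
    exact IELReal.complete (IELReal.sound
      (by rintro F ⟨A, rfl⟩ w; exact IELReal.sound_strong rfl A w) h)
  · intro h
    exact IELReal.complete (IELReal.sound (by simp) h)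
end
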